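/- arXiv:1112.4248 — 4 statements merged into one kernel-verified Lean document; each statement's English description precedes it below -/
import Mathlib

section
/- Let d ≥ 1, let r_1,...,r_d be nonnegative integers with r_k ≤ R for all k, and let ε ∈ (0,1). Consider the family λ(j) = ∏_{k=1}^d (2 j_k − 1)^{−2(r_k+1)} indexed by tuples j = (j_1,...,j_d) of positive integers; this family is summable. If S is a finite set of such tuples with ∑_{j ∉ S} λ(j) ≤ ε² ∑_{j} λ(j), then the cardinality of S satisfies |S| ≥ (1−ε²)(1 + 3^{−2(R+1)})^d. -/
open Finset in
/-- Products of nonnegative summable families, one for each coordinate, are summable. -/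
theorem summable_pi_prod_of_nonneg {ι α : Type*} [Fintype ι] {f : ι → α → ℝ}
    (hf0 : ∀ k n, 0 ≤ f k n) (hf : ∀ k, Summable (f k)) :
    Summable (fun j : ι → α => ∏ k, f k (j k)) := by
  classical
  refine summable_of_sum_le (c := ∏ k, ∑' n, f k n)
    (fun j => prod_nonneg fun k _ => hf0 k _) fun u => ?_
  calc ∑ j ∈ u, ∏ k, f k (j k)
      ≤ ∑ j ∈ Fintype.piFinset fun k => u.image fun j => j k, ∏ k, f k (j k) := by
        refine sum_le_sum_of_subset_of_nonneg (fun j hj => ?_)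
          fun j _ _ => prod_nonneg fun k _ => hf0 k _
        exact Fintype.mem_piFinset.2 fun k => mem_image_of_mem _ hj
    _ = ∏ k, ∑ n ∈ u.image fun j => j k, f k n := (prod_univ_sum _ _).symm
    _ ≤ ∏ k, ∑' n, f k n :=
        prod_le_prod (fun k _ => sum_nonneg fun n _ => hf0 k n)
          fun k _ => (hf k).sum_le_tsum _ fun n _ => hf0 k n

theorem summable_two_mul_add_one_rpow_neg (m : ℕ) :
    Summable (fun n : ℕ => (2 * (n : ℝ) + 1) ^ (-(2 * ((m : ℝ) + 1)))) := by
  have h : Summable (fun n : ℕ => (n : ℝ) ^ (-(2 * ((m : ℝ) + 1)))) :=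
    Real.summable_nat_rpow.2 (by linarith [m.cast_nonneg (α := ℝ)])
  have hinj : Function.Injective fun n : ℕ => 2 * n + 1 := fun a b hab => by
    dsimp only at hab
    omega
  simpa [Function.comp_def] using h.comp_injective hinj

/-- curse of dimensionality for the Euler process with uniformly bounded
smoothness. Tuples of positive integers `(j_1,…,j_d)` are modelled as `j : Fin d → ℕ`
with `j_k = j k + 1`, so `2 j_k - 1 = 2 (j k) + 1`. -/
theorem stmt_5 (d : ℕ) (hd : 1 ≤ d) (r : Fin d → ℕ) (R : ℕ) (hR : ∀ k, r k ≤ R)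
    (ε : ℝ) (hε : ε ∈ Set.Ioo (0 : ℝ) 1) :
    Summable (fun j : Fin d → ℕ =>
      ∏ k, (2 * (j k : ℝ) + 1) ^ (-(2 * ((r k : ℝ) + 1)))) ∧
    ∀ S : Finset (Fin d → ℕ),
      (∑' j : {j : Fin d → ℕ // j ∉ S},
          ∏ k, (2 * (j.1 k : ℝ) + 1) ^ (-(2 * ((r k : ℝ) + 1)))) ≤
        ε ^ 2 * ∑' j : Fin d → ℕ,
          ∏ k, (2 * (j k : ℝ) + 1) ^ (-(2 * ((r k : ℝ) + 1))) →
      (1 - ε ^ 2) * (1 + (3 : ℝ) ^ (-(2 * ((R : ℝ) + 1)))) ^ d ≤ (S.card : ℝ) := by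
  have hpos (k : Fin d) (n : ℕ) : 0 ≤ (2 * (n : ℝ) + 1) ^ (-(2 * ((r k : ℝ) + 1))) := by
    positivity
  have hsum := summable_pi_prod_of_nonneg hpos fun k => summable_two_mul_add_one_rpow_neg (r k)
  refine ⟨hsum, fun S hS => ?_⟩
  have hsplit := hsum.sum_add_tsum_subtype_compl S
  have hcard : ∑ j ∈ S, ∏ k, (2 * (j k : ℝ) + 1) ^ (-(2 * ((r k : ℝ) + 1))) ≤ S.card := by
    refine (Finset.sum_le_card_nsmul S _ 1 fun j _ => ?_).trans_eq (by simp)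
    refine Finset.prod_le_one (fun k _ => hpos k _) fun k _ => ?_
    exact Real.rpow_le_one_of_one_le_of_nonpos
      (by linarith [(j k).cast_nonneg (α := ℝ)]) (by linarith [(r k).cast_nonneg (α := ℝ)])
  have hlower : (1 + (3 : ℝ) ^ (-(2 * ((R : ℝ) + 1)))) ^ d ≤
      ∑' j : Fin d → ℕ, ∏ k, (2 * (j k : ℝ) + 1) ^ (-(2 * ((r k : ℝ) + 1))) := by
    calc (1 + (3 : ℝ) ^ (-(2 * ((R : ℝ) + 1)))) ^ d
        = ∏ _k : Fin d, (1 + (3 : ℝ) ^ (-(2 * ((R : ℝ) + 1)))) := by simp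
      _ ≤ ∏ k : Fin d, ∑ n ∈ Finset.range 2,
            (2 * (n : ℝ) + 1) ^ (-(2 * ((r k : ℝ) + 1))) := by
          refine Finset.prod_le_prod (fun k _ => by positivity) fun k _ => ?_
          have hk : (r k : ℝ) ≤ R := by exact_mod_cast hR k
          have h3 : (3 : ℝ) ^ (-(2 * ((R : ℝ) + 1))) ≤ 3 ^ (-(2 * ((r k : ℝ) + 1))) :=
            Real.rpow_le_rpow_of_exponent_le (by norm_num) (by linarith)
          have h21 : (2 : ℝ) * 1 + 1 = 3 := by norm_num
          simp only [Finset.sum_range_succ, Finset.sum_range_zero, Nat.cast_zero, Nat.cast_one,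
            mul_zero, zero_add, Real.one_rpow, h21]
          linarith
      _ = ∑ j ∈ Fintype.piFinset fun _ : Fin d => Finset.range 2,
            ∏ k, (2 * (j k : ℝ) + 1) ^ (-(2 * ((r k : ℝ) + 1))) :=
          Finset.prod_univ_sum (fun _ => Finset.range 2)
            fun k n => (2 * (n : ℝ) + 1) ^ (-(2 * ((r k : ℝ) + 1)))
      _ ≤ _ := hsum.sum_le_tsum _ fun j _ => Finset.prod_nonneg fun k _ => hpos k _
  have hε' : 0 ≤ 1 - ε ^ 2 := by nlinarith [hε.1, hε.2]
  have := mul_le_mul_of_nonneg_left hlower hε'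
  linarith
end

section
/- Let r be an integer with r ≥ 2 and let t ∈ [0,1]. Then ∫₀¹ ( t^r (1−u)^r − ((t−u)₊)^r )² du ≤ (3 r² / (2r−2)³) · t^{2r−2} (1−t)², where x₊ = max(x,0). -/
theorem integral_sq_mul_one_sub_pow (n : ℕ) :
    ∫ u in (0 : ℝ)..1, u ^ 2 * (1 - u) ^ n =
      2 / (((n : ℝ) + 1) * (n + 2) * (n + 3)) := by
  have h := intervalIntegral.integral_comp_sub_left (a := 0) (b := 1)
    (fun v : ℝ => (1 - v) ^ 2 * v ^ n) 1
  simp only [sub_sub_cancel, sub_self, sub_zero] at h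
  have expand : ∀ v : ℝ, (1 - v) ^ 2 * v ^ n = v ^ n - 2 * v ^ (n + 1) + v ^ (n + 2) :=
    fun v => by ring
  simp_rw [h, expand]
  rw [intervalIntegral.integral_add, intervalIntegral.integral_sub,
    intervalIntegral.integral_const_mul, integral_pow, integral_pow, integral_pow]
  · push_cast
    simp only [one_pow, ne_eq, Nat.add_eq_zero_iff, one_ne_zero, and_false, not_false_eq_true,
      zero_pow, sub_zero]
    have h1 : (n : ℝ) + 1 + 1 = n + 2 := by ring
    have h2 : (n : ℝ) + 2 + 1 = n + 3 := by ring
    rw [h1, h2]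
    field_simp
    ring
  all_goals exact Continuous.intervalIntegrable (by fun_prop) _ _

theorem sq_pow_sub_pow_max_le (r : ℕ) {t u : ℝ} (ht : t ∈ Set.Icc (0 : ℝ) 1)
    (hu : u ∈ Set.Icc (0 : ℝ) 1) :
    (t ^ r * (1 - u) ^ r - (max (t - u) 0) ^ r) ^ 2 ≤
      (r : ℝ) ^ 2 * t ^ (2 * r - 2) * (1 - t) ^ 2 * (u ^ 2 * (1 - u) ^ (2 * r - 2)) := by
  obtain ⟨ht0, ht1⟩ := ht
  obtain ⟨hu0, hu1⟩ := hu
  have ha : 0 ≤ t * (1 - u) := mul_nonneg ht0 (by linarith)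
  have hb : 0 ≤ max (t - u) 0 := le_max_right _ _
  have hba : max (t - u) 0 ≤ t * (1 - u) := max_le (by nlinarith) ha
  have hdiff : t * (1 - u) - max (t - u) 0 ≤ u * (1 - t) := by
    linarith [le_max_left (t - u) 0]
  have key := abs_pow_sub_pow_le (t * (1 - u)) (max (t - u) 0) r
  rw [abs_of_nonneg (sub_nonneg.2 hba), abs_of_nonneg ha, abs_of_nonneg hb,
    max_eq_left hba] at key
  calc (t ^ r * (1 - u) ^ r - (max (t - u) 0) ^ r) ^ 2
      = |(t * (1 - u)) ^ r - (max (t - u) 0) ^ r| ^ 2 := by rw [sq_abs, mul_pow]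
    _ ≤ (u * (1 - t) * r * (t * (1 - u)) ^ (r - 1)) ^ 2 := by
        gcongr
        exact key.trans (by gcongr)
    _ = _ := by
        rw [show 2 * r - 2 = (r - 1) * 2 by omega, pow_mul, pow_mul, mul_pow t]
        ring

/-- Lemma 1, pointwise bound: for `r ≥ 2` and `t ∈ [0,1]`,
`∫₀¹ (t^r (1-u)^r - ((t-u)₊)^r)² du ≤ (3r²/(2r-2)³) t^{2r-2} (1-t)²`. -/
theorem stmt_13 (r : ℕ) (hr : 2 ≤ r) (t : ℝ) (ht : t ∈ Set.Icc (0 : ℝ) 1) :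
    ∫ u in (0 : ℝ)..1, (t ^ r * (1 - u) ^ r - (max (t - u) 0) ^ r) ^ 2 ≤
      (3 * (r : ℝ) ^ 2 / (2 * (r : ℝ) - 2) ^ 3) * t ^ (2 * r - 2) * (1 - t) ^ 2 := by
  have ht0 := ht.1
  have hn : 0 < 2 * (r : ℝ) - 2 := by
    have : (2 : ℝ) ≤ r := by exact_mod_cast hr
    linarith
  have hcast : ((2 * r - 2 : ℕ) : ℝ) = 2 * (r : ℝ) - 2 := by
    push_cast [show 2 ≤ 2 * r by omega]
    ring
  have hconst : 2 / ((2 * (r : ℝ) - 2 + 1) * (2 * (r : ℝ) - 2 + 2) * (2 * (r : ℝ) - 2 + 3)) ≤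
      3 / (2 * (r : ℝ) - 2) ^ 3 := by
    generalize 2 * (r : ℝ) - 2 = x at hn
    rw [pow_three, ← mul_assoc]
    gcongr <;> linarith
  calc ∫ u in (0 : ℝ)..1, (t ^ r * (1 - u) ^ r - (max (t - u) 0) ^ r) ^ 2
      ≤ ∫ u in (0 : ℝ)..1,
          (r : ℝ) ^ 2 * t ^ (2 * r - 2) * (1 - t) ^ 2 * (u ^ 2 * (1 - u) ^ (2 * r - 2)) := by
        apply intervalIntegral.integral_mono_on zero_le_one
        · exact Continuous.intervalIntegrable (by fun_prop) _ _
        · exact Continuous.intervalIntegrable (by fun_prop) _ _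
        · exact fun u hu => sq_pow_sub_pow_max_le r ht hu
    _ ≤ (r : ℝ) ^ 2 * t ^ (2 * r - 2) * (1 - t) ^ 2 * (3 / (2 * (r : ℝ) - 2) ^ 3) := by
        rw [intervalIntegral.integral_const_mul, integral_sq_mul_one_sub_pow, hcast]
        gcongr
    _ = _ := by ring
end

section
/- Let r be an integer with r ≥ 2. Then ∫₀¹ ∫₀¹ ( t^r (1−u)^r − ((t−u)₊)^r )² du dt ≤ 6 r² / (2r−2)⁶, where x₊ = max(x,0). -/
/-- The polynomial `t ^ n * (1 - t) ^ 2` integrates to the Beta value `B(n + 1, 3)`. -/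
theorem integral_pow_mul_one_sub_sq (n : ℕ) :
    ∫ t in (0 : ℝ)..1, t ^ n * (1 - t) ^ 2 = 2 / (((n : ℝ) + 1) * (n + 2) * (n + 3)) := by
  have h : ∀ t : ℝ, t ^ n * (1 - t) ^ 2 = t ^ n - 2 * t ^ (n + 1) + t ^ (n + 2) := fun t => by ring
  simp only [h]
  rw [intervalIntegral.integral_add, intervalIntegral.integral_sub,
    intervalIntegral.integral_const_mul, integral_pow, integral_pow, integral_pow]
  · push_cast
    simp only [one_pow, ne_eq, Nat.succ_ne_zero, not_false_eq_true, zero_pow, sub_zero]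
    field_simp
    ring
  all_goals exact Continuous.intervalIntegrable (by fun_prop) _ _

theorem integral_one_sub_pow_mul_sq (n : ℕ) :
    ∫ u in (0 : ℝ)..1, (1 - u) ^ n * u ^ 2 = 2 / (((n : ℝ) + 1) * (n + 2) * (n + 3)) := by
  have h := intervalIntegral.integral_comp_sub_left (a := 0) (b := 1)
    (fun t : ℝ => t ^ n * (1 - t) ^ 2) 1
  simpa [integral_pow_mul_one_sub_sq] using h

theorem pow_succ_sub_pow_succ_le {a b : ℝ} (hb : 0 ≤ b) (hab : b ≤ a) (s : ℕ) :
    a ^ (s + 1) - b ^ (s + 1) ≤ (s + 1) * a ^ s * (a - b) := by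
  induction s with
  | zero => simp
  | succ s ih =>
    have h1 : b ^ (s + 1) ≤ a ^ (s + 1) := pow_le_pow_left₀ hb hab _
    have h2 := mul_le_mul_of_nonneg_left ih (hb.trans hab)
    have h3 := mul_le_mul_of_nonneg_right h1 (sub_nonneg.2 hab)
    push_cast
    calc a ^ (s + 1 + 1) - b ^ (s + 1 + 1)
        = a * (a ^ (s + 1) - b ^ (s + 1)) + b ^ (s + 1) * (a - b) := by ring
      _ ≤ a * ((s + 1) * a ^ s * (a - b)) + a ^ (s + 1) * (a - b) := add_le_add h2 h3
      _ = _ := by ring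

theorem sq_kernel_sub_le (s : ℕ) {t u : ℝ} (ht : t ∈ Set.Icc (0 : ℝ) 1)
    (hu : u ∈ Set.Icc (0 : ℝ) 1) :
    (t ^ (s + 1) * (1 - u) ^ (s + 1) - (max (t - u) 0) ^ (s + 1)) ^ 2 ≤
      ((s + 1) ^ 2 * (t ^ (2 * s) * (1 - t) ^ 2)) * ((1 - u) ^ (2 * s) * u ^ 2) := by
  obtain ⟨ht0, ht1⟩ := ht
  obtain ⟨hu0, hu1⟩ := hu
  have hb : 0 ≤ max (t - u) 0 := le_max_right _ _
  have ha : 0 ≤ t * (1 - u) := mul_nonneg ht0 (sub_nonneg.2 hu1)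
  have hab : max (t - u) 0 ≤ t * (1 - u) := max_le (by nlinarith) ha
  have hd : t * (1 - u) - max (t - u) 0 ≤ u * (1 - t) := by
    linarith [le_max_left (t - u) 0]
  have hpow := pow_le_pow_left₀ hb hab (s + 1)
  rw [← mul_pow]
  calc ((t * (1 - u)) ^ (s + 1) - (max (t - u) 0) ^ (s + 1)) ^ 2
      ≤ ((s + 1) * (t * (1 - u)) ^ s * (u * (1 - t))) ^ 2 := by
        refine pow_le_pow_left₀ (sub_nonneg.2 hpow)
          ((pow_succ_sub_pow_succ_le hb hab s).trans ?_) 2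
        gcongr
    _ = _ := by rw [mul_pow t]; ring

/-- Lemma 1, integrated bound: for `r ≥ 2`,
`∫₀¹∫₀¹ (t^r (1-u)^r - ((t-u)₊)^r)² du dt ≤ 6r²/(2r-2)⁶`. -/
theorem stmt_14 (r : ℕ) (hr : 2 ≤ r) :
    (∫ t in (0 : ℝ)..1, ∫ u in (0 : ℝ)..1,
        (t ^ r * (1 - u) ^ r - (max (t - u) 0) ^ r) ^ 2) ≤
      6 * (r : ℝ) ^ 2 / (2 * (r : ℝ) - 2) ^ 6 := by
  obtain ⟨s, rfl⟩ : ∃ s, r = s + 1 := ⟨r - 1, by omega⟩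
  have hs : (0 : ℝ) < s := by exact_mod_cast (by omega : 0 < s)
  have hinner : ∀ t ∈ Set.Icc (0 : ℝ) 1,
      ∫ u in (0 : ℝ)..1, (t ^ (s + 1) * (1 - u) ^ (s + 1) - (max (t - u) 0) ^ (s + 1)) ^ 2 ≤
        ∫ u in (0 : ℝ)..1,
          ((s + 1) ^ 2 * (t ^ (2 * s) * (1 - t) ^ 2)) * ((1 - u) ^ (2 * s) * u ^ 2) := by
    intro t ht
    exact intervalIntegral.integral_mono_on zero_le_one
      (Continuous.intervalIntegrable (by fun_prop) _ _)
      (Continuous.intervalIntegrable (by fun_prop) _ _) fun u hu => sq_kernel_sub_le s ht hu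
  simp only [intervalIntegral.integral_const_mul] at hinner
  refine (intervalIntegral.integral_mono_on zero_le_one
    (Continuous.intervalIntegrable ?_ _ _) (Continuous.intervalIntegrable ?_ _ _) hinner).trans ?_
  · exact intervalIntegral.continuous_parametric_intervalIntegral_of_continuous' (by fun_prop) _ _
  · fun_prop
  rw [intervalIntegral.integral_mul_const, intervalIntegral.integral_const_mul,
    integral_pow_mul_one_sub_sq, integral_one_sub_pow_mul_sq]
  push_cast
  have hprod : (2 * s : ℝ) ^ 3 ≤ (2 * s + 1) * (2 * s + 2) * (2 * s + 3) := by
    nlinarith [pow_pos hs 2]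
  calc ((s : ℝ) + 1) ^ 2 * (2 / ((2 * (s : ℝ) + 1) * (2 * s + 2) * (2 * s + 3))) *
        (2 / ((2 * (s : ℝ) + 1) * (2 * s + 2) * (2 * s + 3)))
      = 4 * ((s : ℝ) + 1) ^ 2 / ((2 * (s : ℝ) + 1) * (2 * s + 2) * (2 * s + 3)) ^ 2 := by
        rw [div_eq_mul_inv, div_eq_mul_inv, ← inv_pow]
        generalize (_ : ℝ)⁻¹ = c
        ring
    _ ≤ 6 * ((s : ℝ) + 1) ^ 2 / ((2 * (s : ℝ)) ^ 3) ^ 2 := by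
        gcongr
        norm_num
    _ = 6 * ((s : ℝ) + 1) ^ 2 / (2 * ((s : ℝ) + 1) - 2) ^ 6 := by
        rw [← pow_mul, mul_add 2 (s : ℝ) 1, mul_one, add_sub_cancel_right]
end

section
/- Let r be an integer with r ≥ 3 and let t ∈ [0,1]. Then ∫₀¹ ( t^r (1−u)^r − r t^{r−1}(1−t) u (1−u)^{r−1} − ((t−u)₊)^r )² du ≤ (14 r² (r−1)² / (2r−4)⁵) · t^{2r−4} (1−t)⁴, where x₊ = max(x,0). -/
/-- The first-order Taylor remainder of `x ↦ x₊ ^ (n + 2)` at `a ≥ 0` with step `-d ≤ 0`. -/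
theorem posPart_pow_taylor_remainder_mem_Icc (n : ℕ) {a d : ℝ} (ha : 0 ≤ a) (hd : 0 ≤ d) :
    (max (a - d) 0) ^ (n + 2) - a ^ (n + 2) + ((n : ℝ) + 2) * a ^ (n + 1) * d ∈
      Set.Icc 0 (((n : ℝ) + 2) * (n + 1) / 2 * (a ^ n * d ^ 2)) := by
  have hn : (0 : ℝ) ≤ n := n.cast_nonneg
  rcases le_total d a with h | h
  · rw [max_eq_left (sub_nonneg.2 h)]
    clear hn
    induction n with
    | zero => constructor <;> norm_num <;> nlinarith [sq_nonneg d]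
    | succ n ih =>
      obtain ⟨ih0, ih1⟩ := ih
      have key : (a - d) ^ (n + 1 + 2) - a ^ (n + 1 + 2)
          + (((n + 1 : ℕ) : ℝ) + 2) * a ^ (n + 1 + 1) * d
          = (a - d) * ((a - d) ^ (n + 2) - a ^ (n + 2) + ((n : ℝ) + 2) * a ^ (n + 1) * d)
            + ((n : ℝ) + 2) * a ^ (n + 1) * d ^ 2 := by
        push_cast; ring
      rw [key]
      refine ⟨add_nonneg (mul_nonneg (sub_nonneg.2 h) ih0) (by positivity), ?_⟩
      have h1 := mul_le_mul (sub_le_self a hd) ih1 ih0 ha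
      refine (add_le_add_left h1 _).trans (le_of_eq ?_)
      push_cast; ring
  · rw [max_eq_right (sub_nonpos.2 h), zero_pow (by omega)]
    have hs : a * a ≤ a * d := mul_le_mul_of_nonneg_left h ha
    have hs' : a * d ≤ d * d := mul_le_mul_of_nonneg_right h hd
    have han : 0 ≤ a ^ n := pow_nonneg ha n
    constructor
    · have : 0 ≤ a ^ n * (((n : ℝ) + 2) * (a * d) - a * a) :=
        mul_nonneg han (by nlinarith [mul_nonneg ha hd])
      linarith [show a ^ n * (((n : ℝ) + 2) * (a * d) - a * a)
        = 0 - a ^ (n + 2) + ((n : ℝ) + 2) * a ^ (n + 1) * d by ring]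
    · have h2 : 0 ≤ (d - a) ^ 2 + n * (((n : ℝ) + 3) / 2 * (d * d) - a * d) :=
        add_nonneg (sq_nonneg _) (mul_nonneg hn
          (by nlinarith [mul_nonneg hn (mul_self_nonneg d), mul_self_nonneg d]))
      have h3 : a ^ n * ((d - a) ^ 2 + n * (((n : ℝ) + 3) / 2 * (d * d) - a * d))
          = ((n : ℝ) + 2) * (n + 1) / 2 * (a ^ n * d ^ 2)
            - (0 - a ^ (n + 2) + ((n : ℝ) + 2) * a ^ (n + 1) * d) := by ring
      linarith [mul_nonneg han h2]

theorem integral_one_sub_pow_mul_pow_four (m : ℕ) :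
    ∫ u in (0 : ℝ)..1, (1 - u) ^ m * u ^ 4 =
      24 / (((m : ℝ) + 1) * (m + 2) * (m + 3) * (m + 4) * (m + 5)) := by
  have hsub := intervalIntegral.integral_comp_sub_left
    (fun v : ℝ => v ^ m * (1 - v) ^ 4) (a := 0) (b := 1) 1
  simp only [sub_sub_cancel, sub_zero, sub_self] at hsub
  have hexp : ∀ v : ℝ, v ^ m * (1 - v) ^ 4 =
      v ^ m - 4 * v ^ (m + 1) + 6 * v ^ (m + 2) - 4 * v ^ (m + 3) + v ^ (m + 4) :=
    fun v => by ring
  have hi : ∀ f : ℝ → ℝ, Continuous f → IntervalIntegrable f MeasureTheory.volume 0 1 :=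
    fun f hf => hf.intervalIntegrable 0 1
  rw [hsub]
  simp only [hexp]
  rw [intervalIntegral.integral_add (hi _ (by fun_prop)) (hi _ (by fun_prop)),
    intervalIntegral.integral_sub (hi _ (by fun_prop)) (hi _ (by fun_prop)),
    intervalIntegral.integral_add (hi _ (by fun_prop)) (hi _ (by fun_prop)),
    intervalIntegral.integral_sub (hi _ (by fun_prop)) (hi _ (by fun_prop))]
  simp only [intervalIntegral.integral_const_mul, integral_pow, one_pow]
  push_cast
  have hm : (0 : ℝ) ≤ m := m.cast_nonneg
  rw [zero_pow (by omega), zero_pow (by omega), zero_pow (by omega), zero_pow (by omega),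
    zero_pow (by omega)]
  have e2 : (m : ℝ) + 1 + 1 = m + 2 := by ring
  have e3 : (m : ℝ) + 2 + 1 = m + 3 := by ring
  have e4 : (m : ℝ) + 3 + 1 = m + 4 := by ring
  have e5 : (m : ℝ) + 4 + 1 = m + 5 := by ring
  rw [e2, e3, e4, e5]
  field_simp
  ring

/-- Lemma 2, pointwise bound: for `r ≥ 3` and `t ∈ [0,1]`,
`∫₀¹ (t^r (1-u)^r - r t^{r-1}(1-t) u (1-u)^{r-1} - ((t-u)₊)^r)² du
   ≤ (14 r² (r-1)² / (2r-4)⁵) t^{2r-4} (1-t)⁴`. -/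
theorem stmt_15 (r : ℕ) (hr : 3 ≤ r) (t : ℝ) (ht : t ∈ Set.Icc (0 : ℝ) 1) :
    ∫ u in (0 : ℝ)..1,
        (t ^ r * (1 - u) ^ r - (r : ℝ) * t ^ (r - 1) * (1 - t) * u * (1 - u) ^ (r - 1) -
          (max (t - u) 0) ^ r) ^ 2 ≤
      (14 * (r : ℝ) ^ 2 * ((r : ℝ) - 1) ^ 2 / (2 * (r : ℝ) - 4) ^ 5) *
        t ^ (2 * r - 4) * (1 - t) ^ 4 := by
  obtain ⟨n, rfl⟩ : ∃ n, r = n + 2 := ⟨r - 2, by omega⟩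
  have hn : (0 : ℝ) < n := by exact_mod_cast (by omega : 0 < n)
  obtain ⟨ht0, ht1⟩ := ht
  have ht1' : 0 ≤ 1 - t := sub_nonneg.2 ht1
  rw [show n + 2 - 1 = n + 1 by omega, show 2 * (n + 2) - 4 = 2 * n by omega]
  push_cast
  set C : ℝ := (((n : ℝ) + 2) * (n + 1) / 2) ^ 2 * t ^ (2 * n) * (1 - t) ^ 4 with hC
  have hC0 : 0 ≤ C := by positivity
  calc _ ≤ ∫ u in (0 : ℝ)..1, C * ((1 - u) ^ (2 * n) * u ^ 4) := by
        refine intervalIntegral.integral_mono_on zero_le_one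
          (Continuous.intervalIntegrable (by fun_prop) 0 1)
          (Continuous.intervalIntegrable (by fun_prop) 0 1) fun u hu => ?_
        obtain ⟨h0, h1⟩ := posPart_pow_taylor_remainder_mem_Icc n
          (mul_nonneg ht0 (sub_nonneg.2 hu.2)) (mul_nonneg hu.1 ht1')
        rw [show t * (1 - u) - u * (1 - t) = t - u by ring] at h0 h1
        have h2 := pow_le_pow_left₀ h0 h1 2
        simp only [mul_pow t] at h2
        generalize max (t - u) 0 = p at h2 ⊢
        calc _ = _ := by ring
          _ ≤ _ := h2
          _ = _ := by rw [hC]; ring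
    _ = C * (24 / ((2 * (n : ℝ) + 1) * (2 * n + 2) * (2 * n + 3) * (2 * n + 4) * (2 * n + 5))) := by
        rw [intervalIntegral.integral_const_mul, integral_one_sub_pow_mul_pow_four]
        push_cast
        rfl
    _ ≤ C * (56 / (2 * (n : ℝ)) ^ 5) := by
        refine mul_le_mul_of_nonneg_left ?_ hC0
        refine div_le_div₀ (by norm_num) (by norm_num) (by positivity) ?_
        rw [show (2 * (n : ℝ)) ^ 5 = 2 * n * (2 * n) * (2 * n) * (2 * n) * (2 * n) by ring]
        gcongr <;> linarith
    _ = _ := by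
        rw [hC, show 2 * ((n : ℝ) + 2) - 4 = 2 * n by ring]
        ring
end
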